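/- arXiv:1207.1927 — 2 statements merged into one kernel-verified Lean document; each statement's English description precedes it below -/
import Mathlib

section
/- Let the puzzle graph be any connected simple graph on n vertices and let the people graph be the Erdős–Rényi random graph G(n, p_n) with p_n = λ/log n for a fixed constant λ > π²/6. Then the probability P_{p_n}(Solve) that the people graph solves the puzzle tends to 1 as n → ∞. -/
open MeasureTheory Filter Topology

namespace Jigsaw

variable {V : Type*}

/-- Two vertex sets are adjacent in the graph `G` if some element of one is
`G`-adjacent to some element of the other. -/
def SetAdj (G : SimpleGraph V) (U W : Set V) : Prop :=
  ∃ u ∈ U, ∃ w ∈ W, G.Adj u w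

/-- The auxiliary graph on the blocks of a collection `C`, joining pairs of distinct
blocks that are both people-adjacent and puzzle-adjacent. -/
def clusterGraph (Gpe Gpu : SimpleGraph V) (C : Set (Set V)) : SimpleGraph C where
  Adj U W := U ≠ W ∧ SetAdj Gpe U.1 W.1 ∧ SetAdj Gpu U.1 W.1
  symm := ⟨by
    rintro U W ⟨hne, ⟨u, hu, w, hw, ha⟩, ⟨u', hu', w', hw', ha'⟩⟩
    exact ⟨hne.symm, ⟨w, hw, u, hu, ha.symm⟩, ⟨w', hw', u', hu', ha'.symm⟩⟩⟩
  loopless := ⟨fun U h => h.1 rfl⟩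

/-- One step of jigsaw percolation: within each connected component of the cluster
graph, merge all blocks of that component into a single block. -/
def step (Gpe Gpu : SimpleGraph V) (C : Set (Set V)) : Set (Set V) :=
  { S | ∃ cc : (clusterGraph Gpe Gpu C).ConnectedComponent,
      S = ⋃₀ { U : Set V | ∃ h : U ∈ C,
        (clusterGraph Gpe Gpu C).connectedComponentMk ⟨U, h⟩ = cc } }

/-- The partition `C_i` after `i` steps of jigsaw percolation, starting from
singletons. -/
def clusters (Gpe Gpu : SimpleGraph V) : ℕ → Set (Set V)
  | 0 => { S | ∃ v : V, S = {v} }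
  | i + 1 => step Gpe Gpu (clusters Gpe Gpu i)

/-- The people graph `Gpe` solves the puzzle `Gpu`: the process reaches the
partition `{V}`. -/
def Solves (Gpe Gpu : SimpleGraph V) : Prop :=
  ∃ i, clusters Gpe Gpu i = {Set.univ}

/-- `U ⊆ V` is internally solved: jigsaw percolation on `U` with both graphs induced
on `U` ends with the single block `U`. -/
def InternallySolved (Gpe Gpu : SimpleGraph V) (U : Set V) : Prop :=
  Solves (SimpleGraph.induce U Gpe) (SimpleGraph.induce U Gpu)

/-- The graph determined by the Boolean edge indicators `ω`. -/
def graphOf (ω : Sym2 V → Bool) : SimpleGraph V where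
  Adj u v := u ≠ v ∧ ω s(u, v) = true
  symm := ⟨by
    intro u v h
    exact ⟨h.1.symm, by rw [Sym2.eq_swap]; exact h.2⟩⟩
  loopless := ⟨fun u h => h.1 rfl⟩

/-- The Erdős–Rényi measure: each possible edge appears independently with
probability `p` (the parameter is clamped to `[0,1]`, so for `p ∈ [0,1]` each edge
appears with probability exactly `p`). -/
noncomputable def erMeasure (V : Type*) [Fintype V] [DecidableEq V] (p : ℝ) :
    Measure (Sym2 V → Bool) :=
  Measure.pi fun _ : Sym2 V =>
    (PMF.bernoulli (min (Real.toNNReal p) 1) (min_le_right _ _)).toMeasure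

/-- The ring (`n`-cycle) puzzle graph on `Fin n`. -/
def ringGraph (n : ℕ) : SimpleGraph (Fin n) where
  Adj u v := u ≠ v ∧ (((u : ℕ) + 1) % n = (v : ℕ) ∨ ((v : ℕ) + 1) % n = (u : ℕ))
  symm := ⟨fun u v h => ⟨h.1.symm, h.2.symm⟩⟩
  loopless := ⟨fun u h => h.1 rfl⟩

/-- The ring (`n`-cycle) puzzle graph on `ZMod n`. -/
def zmodRing (n : ℕ) : SimpleGraph (ZMod n) where
  Adj u v := u ≠ v ∧ (u + 1 = v ∨ v + 1 = u)
  symm := ⟨fun u v h => ⟨h.1.symm, h.2.symm⟩⟩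
  loopless := ⟨fun u h => h.1 rfl⟩

/-- The interval of residues `[a, b]` in `ZMod n` is `x`-good with respect to the
people graph `Gpe` if some `u ∈ [a, b]` has no people-edge to any vertex of
`[a - x, b + x]`. -/
def xGood {n : ℕ} (Gpe : SimpleGraph (ZMod n)) (x : ℕ) (a b : ℤ) : Prop :=
  ∃ u : ℤ, a ≤ u ∧ u ≤ b ∧
    ∀ w : ℤ, a - x ≤ w → w ≤ b + x → ¬ Gpe.Adj (u : ZMod n) (w : ZMod n)

/-- The star puzzle graph on `Fin n` with all edges to the last vertex. -/
def starGraph (n : ℕ) : SimpleGraph (Fin n) where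
  Adj u v := u ≠ v ∧ ((u : ℕ) = n - 1 ∨ (v : ℕ) = n - 1)
  symm := ⟨fun u v h => ⟨h.1.symm, h.2.symm⟩⟩
  loopless := ⟨fun u h => h.1 rfl⟩

end Jigsaw

namespace Jigsaw

section Det

variable {V : Type*}

lemma clusters_nonempty (G P : SimpleGraph V) (i : ℕ) :
    ∀ U ∈ clusters G P i, U.Nonempty := by
  induction i with
  | zero => rintro U ⟨v, rfl⟩; exact Set.singleton_nonempty v
  | succ i ih =>
    rintro U ⟨cc, rfl⟩
    induction cc using SimpleGraph.ConnectedComponent.ind with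
    | h W =>
      obtain ⟨x, hx⟩ := ih W.1 W.2
      exact ⟨x, W.1, ⟨W.2, rfl⟩, hx⟩

lemma clusters_disj (G P : SimpleGraph V) (i : ℕ) :
    ∀ U ∈ clusters G P i, ∀ W ∈ clusters G P i, ∀ x, x ∈ U → x ∈ W → U = W := by
  induction i with
  | zero =>
    rintro U ⟨v, rfl⟩ W ⟨w, rfl⟩ x hx hy
    rw [Set.mem_singleton_iff] at hx hy
    rw [← hx, ← hy]
  | succ i ih =>
    rintro U ⟨c, rfl⟩ W ⟨d, rfl⟩ x ⟨A, ⟨hA, rfl⟩, hxA⟩ ⟨B, ⟨hB, rfl⟩, hxB⟩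
    have := ih A hA B hB x hxA hxB
    subst this
    rfl

lemma clusters_mono (G P : SimpleGraph V) (i : ℕ) {U : Set V} (hU : U ∈ clusters G P i) :
    ∃ W ∈ clusters G P (i + 1), U ⊆ W :=
  ⟨_, ⟨(clusterGraph G P (clusters G P i)).connectedComponentMk ⟨U, hU⟩, rfl⟩,
    fun _ hx => ⟨U, ⟨hU, rfl⟩, hx⟩⟩

lemma clusters_cover (G P : SimpleGraph V) (i : ℕ) (x : V) :
    ∃ U ∈ clusters G P i, x ∈ U := by
  induction i with
  | zero => exact ⟨{x}, ⟨x, rfl⟩, rfl⟩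
  | succ i ih =>
    obtain ⟨U, hU, hx⟩ := ih
    obtain ⟨W, hW, h⟩ := clusters_mono G P i hU
    exact ⟨W, hW, h hx⟩

/-- The set `A` is contained in a block at some time. -/
def Good (G P : SimpleGraph V) (A : Set V) : Prop :=
  ∃ i, ∃ U ∈ clusters G P i, A ⊆ U

lemma Good.mono {G P : SimpleGraph V} {A B : Set V} (h : Good G P B) (hAB : A ⊆ B) :
    Good G P A := by
  obtain ⟨i, U, hU, hB⟩ := h
  exact ⟨i, U, hU, hAB.trans hB⟩

lemma good_singleton (G P : SimpleGraph V) (v : V) : Good G P {v} :=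
  ⟨0, {v}, ⟨v, rfl⟩, subset_rfl⟩

lemma Good.insert {G P : SimpleGraph V} {A : Set V} (h : Good G P A) {y : V}
    (hG : ∃ x ∈ A, G.Adj x y) (hP : ∃ x ∈ A, P.Adj x y) : Good G P (insert y A) := by
  obtain ⟨i, U, hU, hA⟩ := h
  by_cases hy : y ∈ U
  · exact ⟨i, U, hU, Set.insert_subset hy hA⟩
  obtain ⟨W, hW, hyW⟩ := clusters_cover G P i y
  have hne : (⟨U, hU⟩ : clusters G P i) ≠ ⟨W, hW⟩ := by
    intro h
    have : U = W := congrArg Subtype.val h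
    exact hy (this ▸ hyW)
  obtain ⟨x, hx, hxy⟩ := hG
  obtain ⟨x', hx', hxy'⟩ := hP
  have hadj : (clusterGraph G P (clusters G P i)).Adj ⟨W, hW⟩ ⟨U, hU⟩ :=
    ⟨hne.symm, ⟨y, hyW, x, hA hx, hxy.symm⟩, ⟨y, hyW, x', hA hx', hxy'.symm⟩⟩
  refine ⟨i + 1, _, ⟨(clusterGraph G P (clusters G P i)).connectedComponentMk ⟨U, hU⟩, rfl⟩, ?_⟩
  apply Set.insert_subset
  · exact ⟨W, ⟨hW, SimpleGraph.ConnectedComponent.sound hadj.reachable⟩, hyW⟩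
  · exact fun a ha => ⟨U, ⟨hU, rfl⟩, hA ha⟩

lemma Good.solves {G P : SimpleGraph V} (h : Good G P Set.univ) : Solves G P := by
  obtain ⟨i, U, hU, hA⟩ := h
  have : U = Set.univ := Set.univ_subset_iff.1 hA
  subst this
  refine ⟨i, ?_⟩
  ext W
  constructor
  · intro hW
    obtain ⟨x, hx⟩ := clusters_nonempty G P i W hW
    exact clusters_disj G P i W hW _ hU x hx trivial
  · rintro rfl; exact hU

/-- A proper nonempty set in a connected graph has an outgoing edge. -/
lemma exists_out {P : SimpleGraph V} (hP : P.Connected) {A : Set V} (hne : A.Nonempty)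
    (h : A ≠ Set.univ) : ∃ x ∈ A, ∃ y ∉ A, P.Adj x y := by
  by_contra! hc
  apply h
  obtain ⟨a, ha⟩ := hne
  ext b
  simp only [Set.mem_univ, iff_true]
  obtain ⟨w⟩ := hP.preconnected a b
  induction w with
  | nil => exact ha
  | cons hadj w ih =>
    apply ih
    by_contra hn
    exact hc _ ha _ hn hadj

lemma Good.all [Finite V] {G P : SimpleGraph V} (hP : P.Connected) {A : Set V}
    (hne : A.Nonempty) (h : Good G P A) (hA : ∀ w ∉ A, ∃ a ∈ A, G.Adj a w) : Solves G P := by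
  obtain ⟨B, hAB, hB⟩ := (Set.toFinite {B | Good G P B}).exists_le_maximal h
  apply Good.solves
  by_cases hu : B = Set.univ
  · exact hu ▸ hB.1
  exfalso
  obtain ⟨x, hx, y, hy, hxy⟩ := exists_out hP (hne.mono hAB) hu
  obtain ⟨a, ha, hay⟩ := hA y (fun h => hy (hAB h))
  have := hB.1.insert ⟨a, hAB ha, hay⟩ ⟨x, hx, hxy⟩
  exact hy (hB.2 this (Set.subset_insert _ _) (Set.mem_insert _ _))

/-- Lists built by successively adding adjacent new vertices. -/
inductive Grow (P : SimpleGraph V) : List V → Prop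
  | single (b : V) : Grow P [b]
  | cons (y : V) (l : List V) (h : Grow P l) (hy : y ∉ l) (ha : ∃ x ∈ l, P.Adj x y) :
      Grow P (y :: l)

lemma Grow.nodup {P : SimpleGraph V} {l : List V} (h : Grow P l) : l.Nodup := by
  induction h with
  | single b => simp
  | cons y l h hy ha ih => simp [hy, ih]

lemma Grow.pos {P : SimpleGraph V} {l : List V} (h : Grow P l) : 0 < l.length := by
  cases h <;> simp

lemma Grow.exists_sub {P : SimpleGraph V} {l : List V} (h : Grow P l) (L : ℕ) (hL : 0 < L)
    (hl : L ≤ l.length) : ∃ l', Grow P l' ∧ l'.length = L ∧ l' ⊆ l := by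
  induction h with
  | single b =>
    simp only [List.length_cons, List.length_nil] at hl
    exact ⟨[b], .single b, by simp; omega, fun _ h => h⟩
  | cons y l h hy ha ih =>
    by_cases hh : L ≤ l.length
    · obtain ⟨l', h1, h2, h3⟩ := ih hh
      exact ⟨l', h1, h2, fun x hx => List.mem_cons_of_mem _ (h3 hx)⟩
    · refine ⟨y :: l, .cons y l h hy ha, ?_, fun _ h => h⟩
      simp only [List.length_cons] at hl ⊢
      omega

/-- Every vertex of the list (except the last) is open-connected to a later one. -/
def Op (ω : Sym2 V → Bool) : List V → Prop
  | [] => True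
  | y :: l => (l = [] ∨ ∃ x ∈ l, ω s(x, y) = true) ∧ Op ω l

lemma Op.good {P : SimpleGraph V} {ω : Sym2 V → Bool} {l : List V} (h : Grow P l)
    (ho : Op ω l) : Good (graphOf ω) P {x | x ∈ l} := by
  induction h with
  | single b => exact (good_singleton _ _ b).mono (by intro x; simp)
  | cons y l h hy ha ih =>
    obtain ⟨h1, h2⟩ := ho
    refine Good.mono (Good.insert (ih h2) (y := y) ?_ ha) (by intro x; simp)
    rcases h1 with rfl | ⟨x, hx, hxy⟩
    · cases h
    · exact ⟨x, hx, fun e => hy (e ▸ hx), hxy⟩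

/-- Maximal grown lists inside a set `U`. -/
lemma exists_max_grow [Fintype V] (P : SimpleGraph V) (U : Set V) (b : V) (hb : b ∈ U) :
    ∃ l, Grow P l ∧ b ∈ l ∧ (∀ x ∈ l, x ∈ U) ∧ ∀ x ∈ l, ∀ y ∈ U, P.Adj x y → y ∈ l := by
  classical
  let Q : ℕ → Prop := fun k => ∃ l, Grow P l ∧ b ∈ l ∧ (∀ x ∈ l, x ∈ U) ∧ l.length = k
  have hQ1 : Q 1 := ⟨[b], .single b, by simp, by simpa using hb, rfl⟩
  have hbd : ∀ k, Q k → k ≤ Fintype.card V := by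
    rintro k ⟨l, h, -, -, rfl⟩
    exact h.nodup.length_le_card
  have hs := Nat.findGreatest_spec (P := Q) (hbd 1 hQ1) hQ1
  obtain ⟨l, h1, h2, h3, h4⟩ := hs
  refine ⟨l, h1, h2, h3, fun x hx y hy hxy => ?_⟩
  by_contra hn
  have hq : Q (l.length + 1) := ⟨y :: l, .cons y l h1 hn ⟨x, hx, hxy⟩, by simp [h2],
    by simpa [hy] using h3, by simp⟩
  have := Nat.le_findGreatest (hbd _ hq) hq
  omega

open Classical in
/-- Disjoint families of grown lists of length `L`. -/
lemma exists_family [Fintype V] (P : SimpleGraph V) (hP : P.Connected) (L D : ℕ) (hL : 0 < L)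
    (hLn : L ≤ Fintype.card V) (hD : ∀ v, P.degree v ≤ D) :
    ∃ F : Finset (List V), (∀ l ∈ F, Grow P l ∧ l.length = L) ∧
      (∀ l ∈ F, ∀ l' ∈ F, l ≠ l' → List.Disjoint l l') ∧
      F.card ≤ Fintype.card V ∧
      Fintype.card V ≤ F.card * (L + L * D * L) := by
  let Q : ℕ → Prop := fun k => ∃ F : Finset (List V), (∀ l ∈ F, Grow P l ∧ l.length = L) ∧
      (∀ l ∈ F, ∀ l' ∈ F, l ≠ l' → List.Disjoint l l') ∧ F.card = k
  have hcard : ∀ F : Finset (List V), (∀ l ∈ F, Grow P l ∧ l.length = L) →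
      (F.biUnion List.toFinset).card ≤ F.card * L := by
    intro F h1
    apply Finset.card_biUnion_le_card_mul
    intro l hl
    rw [← (h1 l hl).2]
    exact l.toFinset_card_le
  have hbd : ∀ k, Q k → k ≤ Fintype.card V := by
    rintro k ⟨F, h1, h2, rfl⟩
    have : (F.biUnion List.toFinset).card = ∑ l ∈ F, l.toFinset.card := by
      apply Finset.card_biUnion
      intro l hl l' hl' hne
      exact List.disjoint_toFinset_iff_disjoint.2 (h2 l hl l' hl' hne)
    have h3 : F.card ≤ ∑ l ∈ F, l.toFinset.card := by
      rw [Finset.card_eq_sum_ones]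
      apply Finset.sum_le_sum
      intro l hl
      rw [List.toFinset_card_of_nodup (h1 l hl).1.nodup]
      exact (h1 l hl).1.pos
    calc F.card ≤ _ := h3
      _ = _ := this.symm
      _ ≤ _ := Finset.card_le_univ _
  have hQ0 : Q 0 := ⟨∅, by simp, by simp, rfl⟩
  obtain ⟨F, h1, h2, h4⟩ := Nat.findGreatest_spec (P := Q) (hbd 0 hQ0) hQ0
  have hFn : F.card ≤ Fintype.card V := hbd _ ⟨F, h1, h2, rfl⟩
  refine ⟨F, h1, h2, hFn, ?_⟩
  set S : Finset V := F.biUnion List.toFinset with hS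
  have hmax : ∀ l, Grow P l → (∀ x ∈ l, x ∉ S) → l.length < L := by
    intro l hl hd
    by_contra! hlen
    obtain ⟨l', g1, g2, g3⟩ := hl.exists_sub L hL hlen
    have hdis : ∀ m ∈ F, List.Disjoint l' m := by
      intro m hm x hx hxm
      exact hd x (g3 hx) (Finset.mem_biUnion.2 ⟨m, hm, by simpa using hxm⟩)
    have hl'F : l' ∉ F := by
      intro hm
      have := hdis l' hm
      have hp := g1.pos
      obtain ⟨a, ha⟩ := List.exists_mem_of_length_pos hp
      exact this ha ha
    have hq : Q (F.card + 1) := by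
      refine ⟨insert l' F, ?_, ?_, Finset.card_insert_of_notMem hl'F⟩
      · intro l hl
        rcases Finset.mem_insert.1 hl with rfl | hl
        · exact ⟨g1, g2⟩
        · exact h1 l hl
      · intro a ha b hb hab
        rcases Finset.mem_insert.1 ha with rfl | ha' <;>
          rcases Finset.mem_insert.1 hb with rfl | hb'
        · exact absurd rfl hab
        · exact hdis b hb'
        · exact (hdis a ha').symm
        · exact h2 a ha' b hb' hab
    have := Nat.le_findGreatest (hbd _ hq) hq
    omega
  have hT : ∀ b : V, ∃ T : Finset V, T.card ≤ L ∧ (b ∉ S → b ∈ T) ∧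
      ∀ x ∈ T, ∀ y, y ∉ S → P.Adj x y → y ∈ T := by
    intro b
    by_cases hb : b ∈ S
    · exact ⟨∅, by simp, by simp [hb], by simp⟩
    · obtain ⟨l, a1, a2, a3, a4⟩ := exists_max_grow P {x | x ∉ S} b hb
      refine ⟨l.toFinset, l.toFinset_card_le.trans (hmax l a1 a3).le, by simp [a2], ?_⟩
      intro x hx y hy hxy
      simp only [List.mem_toFinset] at hx ⊢
      exact a4 x hx y hy hxy
  choose T hT1 hT2 hT3 using hT
  have hSne : S.Nonempty := by
    by_contra hne
    rw [Finset.not_nonempty_iff_eq_empty] at hne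
    obtain ⟨v⟩ := hP.nonempty
    obtain ⟨l, a1, a2, a3, a4⟩ := exists_max_grow P {x | x ∉ S} v (by simp [hne])
    have hlt := hmax l a1 a3
    have hun : ({x | x ∈ l} : Set V) = Set.univ := by
      by_contra hu
      obtain ⟨x, hx, y, hy, hxy⟩ := exists_out hP ⟨v, a2⟩ hu
      exact hy (a4 x hx y (by simp [hne]) hxy)
    have hle : Fintype.card V ≤ l.length := by
      calc Fintype.card V = (Finset.univ : Finset V).card := rfl
        _ ≤ l.toFinset.card := Finset.card_le_card (by
            intro x _
            have : x ∈ ({x | x ∈ l} : Set V) := by rw [hun]; trivial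
            simpa using this)
        _ ≤ _ := l.toFinset_card_le
    omega
  set N : Finset V := S.biUnion (fun x => P.neighborFinset x) with hN
  set W : Finset V := S ∪ N.biUnion T with hW
  have hWu : (W : Set V) = Set.univ := by
    by_contra hu
    obtain ⟨s, hs⟩ := hSne
    obtain ⟨x, hx, y, hy, hxy⟩ := exists_out hP ⟨s, by simp [hW, hs]⟩ hu
    have hyS : y ∉ S := fun h => hy (by simp [hW, h])
    apply hy
    rw [Finset.mem_coe] at hx ⊢
    rcases Finset.mem_union.1 hx with hx | hx
    · refine Finset.mem_union_right _ (Finset.mem_biUnion.2 ⟨y, ?_, hT2 y hyS⟩)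
      exact Finset.mem_biUnion.2 ⟨x, hx, by simpa using hxy⟩
    · obtain ⟨b, hb, hxb⟩ := Finset.mem_biUnion.1 hx
      exact Finset.mem_union_right _ (Finset.mem_biUnion.2 ⟨b, hb, hT3 b x hxb y hyS hxy⟩)
  have hSc : S.card ≤ F.card * L := hcard F h1
  have hNc : N.card ≤ S.card * D := by
    apply Finset.card_biUnion_le_card_mul
    intro x _
    exact hD x
  have hTc : (N.biUnion T).card ≤ N.card * L :=
    Finset.card_biUnion_le_card_mul _ _ _ (fun x _ => hT1 x)
  calc Fintype.card V = W.card := by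
        rw [Finset.coe_eq_univ] at hWu; rw [hWu]; rfl
    _ ≤ S.card + (N.biUnion T).card := Finset.card_union_le _ _
    _ ≤ F.card * L + F.card * L * D * L := by gcongr; exact hTc.trans (by gcongr; exact hNc.trans (by gcongr))
    _ = _ := by ring

end Det

end Jigsaw

namespace Jigsaw

lemma q_bound (p : ℝ) (h0 : 0 < p) (h1 : p ≤ 1) (K : ℕ) :
    Real.exp (-(Real.pi ^ 2 / 6 / p)) ≤ ∏ k ∈ Finset.range K, (1 - (1 - p) ^ (k + 1)) := by
  set x := 1 - p with hx
  have hx0 : 0 ≤ x := by linarith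
  have hx1 : x < 1 := by linarith
  have hxk : ∀ k, x ^ (k + 1) < 1 := fun k => pow_lt_one₀ hx0 hx1 (by omega)
  have hpos : ∀ k, 0 < 1 - x ^ (k + 1) := fun k => by linarith [hxk k]
  have hprod : 0 < ∏ k ∈ Finset.range K, (1 - x ^ (k + 1)) := Finset.prod_pos fun k _ => hpos k
  rw [← Real.le_log_iff_exp_le hprod, Real.log_prod (fun k _ => (hpos k).ne')]
  have hs : HasSum (fun j : ℕ => ∑ k ∈ Finset.range K, (x ^ (k + 1)) ^ (j + 1) / ((j : ℝ) + 1))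
      (∑ k ∈ Finset.range K, -Real.log (1 - x ^ (k + 1))) := by
    apply hasSum_sum
    intro k _
    apply Real.hasSum_pow_div_log_of_abs_lt_one
    rw [abs_of_nonneg (by positivity)]
    exact hxk k
  have hz : HasSum (fun j : ℕ => 1 / ((j + 1 : ℕ) : ℝ) ^ 2 / p) (Real.pi ^ 2 / 6 / p) := by
    apply HasSum.div_const
    have := (hasSum_nat_add_iff' (f := fun n : ℕ => 1 / (n : ℝ) ^ 2) 1).2 hasSum_zeta_two
    simpa using this
  have := hasSum_le ?_ hs hz
  · rw [Finset.sum_neg_distrib] at this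
    linarith
  intro j
  have hj : (0 : ℝ) < (j : ℝ) + 1 := by positivity
  set y := x ^ (j + 1) with hy
  have hy0 : 0 ≤ y := by positivity
  have hy1 : y < 1 := hxk j
  have hkey : y * (1 + p * (j + 1)) ≤ 1 := by
    have hb : 1 + p * ((j : ℝ) + 1) ≤ (1 + p) ^ (j + 1) := by
      have := one_add_mul_le_pow (a := p) (by linarith) (j + 1)
      push_cast at this
      linarith
    calc y * (1 + p * (j + 1)) ≤ x ^ (j + 1) * (1 + p) ^ (j + 1) := by gcongr
      _ = ((1 - p) * (1 + p)) ^ (j + 1) := by rw [mul_pow]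
      _ ≤ 1 := pow_le_one₀ (by nlinarith) (by nlinarith)
  have hgeo : ∑ k ∈ Finset.range K, y ^ (k + 1) ≤ y / (1 - y) := by
    rw [le_div_iff₀ (by linarith)]
    have := geom_sum_mul_neg y K
    have h2 : ∑ k ∈ Finset.range K, y ^ (k + 1) = y * ∑ k ∈ Finset.range K, y ^ k := by
      rw [Finset.mul_sum]; exact Finset.sum_congr rfl fun k _ => by ring
    rw [h2, mul_assoc, this]
    have : 0 ≤ y ^ K := by positivity
    nlinarith
  have hyb : y / (1 - y) ≤ 1 / (p * (j + 1)) := by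
    rw [div_le_div_iff₀ (by linarith) (by positivity)]
    linarith
  calc ∑ k ∈ Finset.range K, (x ^ (k + 1)) ^ (j + 1) / ((j : ℝ) + 1)
      = (∑ k ∈ Finset.range K, y ^ (k + 1)) / ((j : ℝ) + 1) := by
        rw [Finset.sum_div]
        refine Finset.sum_congr rfl fun k _ => ?_
        rw [hy, ← pow_mul, ← pow_mul, mul_comm]
    _ ≤ (1 / (p * (j + 1))) / ((j : ℝ) + 1) := by
        gcongr
        exact hgeo.trans hyb
    _ = 1 / ((j + 1 : ℕ) : ℝ) ^ 2 / p := by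
        push_cast
        field_simp

end Jigsaw

namespace Jigsaw

section Prob

open ProbabilityTheory

variable {V : Type*} [Fintype V] [DecidableEq V]

instance erMeasure_prob (p : ℝ) : IsProbabilityMeasure (erMeasure V p) := by
  unfold erMeasure; infer_instance

lemma er_indep (p : ℝ) (F F' : Set (Sym2 V)) (hd : Disjoint F F') (A B : Set (Sym2 V → Bool))
    (hA : ∀ ω ω' : Sym2 V → Bool, (∀ e ∈ F, ω e = ω' e) → ω ∈ A → ω' ∈ A)
    (hB : ∀ ω ω' : Sym2 V → Bool, (∀ e ∈ F', ω e = ω' e) → ω ∈ B → ω' ∈ B) :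
    (erMeasure V p).real (A ∩ B) = (erMeasure V p).real A * (erMeasure V p).real B := by
  classical
  have hind : iIndepFun (fun (i : Sym2 V) (ω : Sym2 V → Bool) => ω i) (erMeasure V p) := by
    unfold erMeasure
    exact iIndepFun_pi (X := fun _ x => x) (fun i => aemeasurable_id)
  have h2 := hind.indepFun_finset F.toFinset F'.toFinset (Set.disjoint_toFinset.2 hd)
    (fun i => measurable_pi_apply i)
  have h3 := (indepFun_iff_measure_inter_preimage_eq_mul.1 h2)
    ((fun (a : Sym2 V → Bool) (i : F.toFinset) => a i) '' A)
    ((fun (a : Sym2 V → Bool) (i : F'.toFinset) => a i) '' B)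
    (Set.toFinite _).measurableSet (Set.toFinite _).measurableSet
  have key : ∀ (F : Set (Sym2 V)) (A : Set (Sym2 V → Bool)),
      (∀ ω ω' : Sym2 V → Bool, (∀ e ∈ F, ω e = ω' e) → ω ∈ A → ω' ∈ A) →
      (fun (a : Sym2 V → Bool) (i : F.toFinset) => a i) ⁻¹'
        ((fun (a : Sym2 V → Bool) (i : F.toFinset) => a i) '' A) = A := by
    intro F A hA
    apply Set.Subset.antisymm _ (Set.subset_preimage_image _ _)
    rintro ω ⟨ω', h', he⟩
    refine hA ω' ω (fun e hmem => ?_) h'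
    exact congrFun he ⟨e, by simpa using hmem⟩
  rw [key F A hA, key F' B hB] at h3
  simp only [Measure.real, h3, ENNReal.toReal_mul]

lemma er_cyl (p : ℝ) (h0 : 0 ≤ p) (h1 : p ≤ 1) (b : Bool) (F : Finset (Sym2 V)) :
    (erMeasure V p).real {ω | ∀ e ∈ F, ω e = b} = (if b then p else 1 - p) ^ F.card := by
  have hset : {ω : Sym2 V → Bool | ∀ e ∈ F, ω e = b} =
      Set.pi Set.univ (fun e => if e ∈ F then {b} else Set.univ) := by
    ext ω
    simp only [Set.mem_ofPred_eq, Set.mem_pi, Set.mem_univ, true_imp_iff]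
    refine forall_congr' fun e => ?_
    by_cases h : e ∈ F <;> simp [h]
  have hp : (min (Real.toNNReal p) 1 : NNReal) = Real.toNNReal p :=
    min_eq_left (by simpa using h1)
  have hb : ((PMF.bernoulli (min (Real.toNNReal p) 1) (min_le_right _ _)).toMeasure {b}).toReal
      = if b then p else 1 - p := by
    rw [PMF.toMeasure_apply_singleton _ _ (measurableSet_singleton b), PMF.bernoulli_apply]
    cases b
    · simp [h0, h1, NNReal.coe_sub]
    · simp [h0, h1]
  rw [Measure.real, hset, erMeasure, Measure.pi_pi, ENNReal.toReal_prod]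
  rw [← Finset.prod_const, ← Finset.prod_subset (Finset.subset_univ F)]
  · refine Finset.prod_congr rfl fun e he => ?_
    rw [if_pos he, hb]
  · intro e _ he
    rw [if_neg he, measure_univ]
    rfl

lemma er_compl (p : ℝ) (A : Set (Sym2 V → Bool)) :
    (erMeasure V p).real Aᶜ = 1 - (erMeasure V p).real A :=
  probReal_compl_eq_one_sub (Set.toFinite _).measurableSet

/-- No vertex of `l` is joined to `y`. -/
lemma er_none (p : ℝ) (h0 : 0 ≤ p) (h1 : p ≤ 1) (l : List V) (hl : l.Nodup) (y : V) :
    (erMeasure V p).real {ω | ∀ x ∈ l, ω s(x, y) = false} = (1 - p) ^ l.length := by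
  have := er_cyl p h0 h1 false (l.toFinset.image (fun x => s(x, y)))
  rw [Finset.card_image_of_injective, List.toFinset_card_of_nodup hl] at this
  · simpa using this
  · intro a b hab
    exact Sym2.congr_left.1 hab

lemma op_dep (l : List V) (ω ω' : Sym2 V → Bool) (h : ∀ e, (∀ x ∈ e, x ∈ l) → ω e = ω' e)
    (ho : Op ω l) : Op ω' l := by
  induction l with
  | nil => trivial
  | cons y l ih =>
    obtain ⟨a, b⟩ := ho
    refine ⟨?_, ih (fun e he => h e (fun x hx => List.mem_cons_of_mem _ (he x hx))) b⟩
    rcases a with a | ⟨x, hx, hxy⟩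
    · exact Or.inl a
    · refine Or.inr ⟨x, hx, ?_⟩
      rw [← h _ _]
      · exact hxy
      · intro z hz
        rcases Sym2.mem_iff.1 hz with rfl | rfl <;> simp [hx]

lemma er_op (p : ℝ) (h0 : 0 ≤ p) (h1 : p ≤ 1) (l : List V) (hl : l.Nodup) :
    (erMeasure V p).real {ω | Op ω l} =
      ∏ k ∈ Finset.range (l.length - 1), (1 - (1 - p) ^ (k + 1)) := by
  induction l with
  | nil => simp [Op]
  | cons y l ih =>
    rw [List.nodup_cons] at hl
    by_cases hne : l = []
    · subst hne; simp [Op]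
    have hset : {ω : Sym2 V → Bool | Op ω (y :: l)} =
        {ω | ∀ x ∈ l, ω s(x, y) = false}ᶜ ∩ {ω | Op ω l} := by
      ext ω
      simp [Op, hne]
    rw [hset, er_indep p {e | y ∈ e} {e | ∀ x ∈ e, x ∈ l}, er_compl, er_none p h0 h1 l hl.2 y, ih hl.2]
    · have hpos : 0 < l.length := List.length_pos_iff.2 hne
      obtain ⟨k, hk⟩ : ∃ k, l.length = k + 1 := ⟨l.length - 1, by omega⟩
      rw [List.length_cons, hk]
      simp only [Nat.add_sub_cancel]
      rw [Finset.prod_range_succ, mul_comm]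
    · rw [Set.disjoint_left]
      exact fun e he he' => hl.1 (he' y he)
    · intro ω ω' h hω ho
      apply hω
      intro x hx
      rw [h _ (by simp), ho x hx]
    · exact fun ω ω' h ho => op_dep l ω ω' h ho

/-- None of the lists in a disjoint family is open. -/
lemma er_family (p : ℝ) (q : ℝ) (F : Finset (List V))
    (hq : ∀ l ∈ F, (erMeasure V p).real {ω | Op ω l} = q)
    (hd : ∀ l ∈ F, ∀ l' ∈ F, l ≠ l' → List.Disjoint l l') :
    (erMeasure V p).real {ω | ∀ l ∈ F, ¬ Op ω l} = (1 - q) ^ F.card := by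
  classical
  induction F using Finset.induction_on with
  | empty => simp
  | insert l F hl ih =>
    have hset : {ω : Sym2 V → Bool | ∀ m ∈ insert l F, ¬ Op ω m} =
        {ω | Op ω l}ᶜ ∩ {ω | ∀ m ∈ F, ¬ Op ω m} := by
      ext ω
      simp
    rw [hset, er_indep p {e | ∀ x ∈ e, x ∈ l} {e | ∃ m ∈ F, ∀ x ∈ e, x ∈ m}, er_compl,
      hq l (Finset.mem_insert_self _ _), ih (fun m hm => hq m (Finset.mem_insert_of_mem hm)),
      Finset.card_insert_of_notMem hl, pow_succ, mul_comm]
    · exact fun a ha b hb => hd a (Finset.mem_insert_of_mem ha) b (Finset.mem_insert_of_mem hb)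
    · rw [Set.disjoint_left]
      rintro e he ⟨m, hm, he'⟩
      induction e with | _ a b =>
      exact hd l (Finset.mem_insert_self _ _) m (Finset.mem_insert_of_mem hm)
        (fun h => hl (h ▸ hm)) (he a (by simp)) (he' a (by simp))
    · intro ω ω' h hω ho
      exact hω (op_dep l ω' ω (fun e he => (h e he).symm) ho)
    · intro ω ω' h hω m hm ho
      exact hω m hm (op_dep m ω' ω (fun e he => (h e ⟨m, hm, he⟩).symm) ho)

/-- No two-step path from `v` to `w` through `N`. -/
lemma er_two (p : ℝ) (h0 : 0 ≤ p) (h1 : p ≤ 1) (v w : V) (hvw : v ≠ w) (N : Finset V)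
    (hv : v ∉ N) (hw : w ∉ N) :
    (erMeasure V p).real {ω | ∀ u ∈ N, ¬ (ω s(v, u) = true ∧ ω s(w, u) = true)} =
      (1 - p ^ 2) ^ N.card := by
  induction N using Finset.induction_on with
  | empty => simp
  | insert u N hu ih =>
    simp only [Finset.mem_insert, not_or] at hv hw
    have hset : {ω : Sym2 V → Bool | ∀ x ∈ insert u N, ¬ (ω s(v, x) = true ∧ ω s(w, x) = true)} =
        {ω | ∀ e ∈ ({s(v, u), s(w, u)} : Finset (Sym2 V)), ω e = true}ᶜ ∩
        {ω | ∀ x ∈ N, ¬ (ω s(v, x) = true ∧ ω s(w, x) = true)} := by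
      ext ω
      simp [or_imp, forall_and]
    have hcard : ({s(v, u), s(w, u)} : Finset (Sym2 V)).card = 2 := by
      exact Finset.card_pair (fun h => hvw (Sym2.congr_left.1 h))
    rw [hset, er_indep p {e | u ∈ e} {e | u ∉ e}, er_compl, er_cyl p h0 h1, hcard,
      ih hv.2 hw.2, Finset.card_insert_of_notMem hu, pow_succ _ N.card, mul_comm]
    · simp
    · rw [Set.disjoint_left]
      exact fun e he he' => he' he
    · intro ω ω' h hω ho
      apply hω
      intro e he
      rw [h e, ho e he]
      simp only [Finset.mem_insert, Finset.mem_singleton] at he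
      rcases he with rfl | rfl <;> simp
    · intro ω ω' h hω x hx ho
      have hxu : u ≠ x := fun e => hu (e ▸ hx)
      apply hω x hx
      rw [h, h]
      · exact ho
      · simp [hxu, Ne.symm hw.1]
      · simp [hxu]
        exact fun e => hv.1 e.symm

/-- High degree case. -/
lemma high_deg (p : ℝ) (h0 : 0 ≤ p) (h1 : p ≤ 1) (P : SimpleGraph V) (hP : P.Connected)
    (D : ℕ) (v : V) (N : Finset V) (hN : ∀ u ∈ N, P.Adj v u) (hD : D + 1 ≤ N.card) :
    (erMeasure V p).real {ω | Solves (graphOf ω) P}ᶜ ≤ Fintype.card V * (1 - p ^ 2) ^ D := by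
  have hvN : v ∉ N := fun h => (hN v h).ne rfl
  have hsub : {ω | Solves (graphOf ω) P}ᶜ ⊆ ⋃ w ∈ Finset.univ.erase v,
      {ω : Sym2 V → Bool | ∀ u ∈ N.erase w, ¬ (ω s(v, u) = true ∧ ω s(w, u) = true)} := by
    intro ω hω
    by_contra hc
    apply hω
    simp only [Set.mem_iUnion, Set.mem_ofPred_eq, not_exists, Finset.mem_erase, Finset.mem_univ,
      and_true] at hc
    push Not at hc
    set M : Finset V := N.filter (fun u => ω s(v, u) = true) with hM
    have hgood : ∀ M' ⊆ M, Good (graphOf ω) P (insert v (M' : Set V)) := by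
      intro M' 
      induction M' using Finset.induction_on with
      | empty => intro _; simpa using good_singleton _ _ v
      | insert u M' hu ih =>
        intro hs
        have hum := Finset.mem_filter.1 (hs (Finset.mem_insert_self _ _))
        have := ih ((Finset.subset_insert _ _).trans hs)
        refine (this.insert (y := u) ⟨v, by simp, (hN u hum.1).ne, hum.2⟩
          ⟨v, by simp, hN u hum.1⟩).mono ?_
        rw [Finset.coe_insert, Set.insert_comm]
    refine Good.all hP ⟨v, by simp⟩ (hgood M subset_rfl) ?_
    intro w hw
    have hwv : w ≠ v := fun h => hw (by simp [h])
    obtain ⟨u, hu, hvu, hwu⟩ := hc w hwv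
    refine ⟨u, ?_, hu.1, ?_⟩
    · simp [hM, hu.2, hvu]
    · rw [Sym2.eq_swap]; exact hwu
  have hpp : 0 ≤ 1 - p ^ 2 := by nlinarith
  calc _ ≤ _ := measureReal_mono hsub (measure_ne_top _ _)
    _ ≤ ∑ w ∈ Finset.univ.erase v, _ := measureReal_biUnion_finset_le _ _
    _ ≤ ∑ w ∈ Finset.univ.erase v, (1 - p ^ 2) ^ D := by
      apply Finset.sum_le_sum
      intro w hw
      rw [er_two p h0 h1 v w (Finset.ne_of_mem_erase hw).symm _ (fun h => hvN (Finset.mem_of_mem_erase h))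
        (Finset.notMem_erase _ _)]
      apply pow_le_pow_of_le_one hpp (by nlinarith)
      have := Finset.pred_card_le_card_erase (s := N) (a := w)
      omega
    _ ≤ _ := by
      rw [Finset.sum_const, nsmul_eq_mul]
      gcongr
      exact Finset.card_le_univ _

/-- Low degree case. -/
lemma low_deg (p : ℝ) (h0 : 0 < p) (h1 : p ≤ 1) (P : SimpleGraph V) (hP : P.Connected)
    (L : ℕ) (F : Finset (List V)) (hF : ∀ l ∈ F, Grow P l ∧ l.length = L)
    (hd : ∀ l ∈ F, ∀ l' ∈ F, l ≠ l' → List.Disjoint l l') (hFn : F.card ≤ Fintype.card V) :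
    (erMeasure V p).real {ω | Solves (graphOf ω) P}ᶜ ≤
      Fintype.card V * (Fintype.card V * (1 - p) ^ L) +
      Real.exp (-(Real.exp (-(Real.pi ^ 2 / 6 / p)) * F.card)) := by
  classical
  have hsub : {ω | Solves (graphOf ω) P}ᶜ ⊆ (⋃ l ∈ F, ⋃ w ∈ (Finset.univ : Finset V),
      {ω : Sym2 V → Bool | ∀ x ∈ l, ω s(x, w) = false}) ∪ {ω | ∀ l ∈ F, ¬ Op ω l} := by
    intro ω hω
    by_contra hc
    apply hω
    rw [Set.mem_union, not_or] at hc
    obtain ⟨hc1, hc2⟩ := hc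
    simp only [Set.mem_iUnion, Set.mem_ofPred_eq, not_exists] at hc1 hc2
    push Not at hc2
    obtain ⟨l, hl, ho⟩ := hc2
    obtain ⟨a, ha⟩ := List.exists_mem_of_length_pos (hF l hl).1.pos
    refine Good.all hP ⟨a, ha⟩ (ho.good (hF l hl).1) ?_
    intro w hw
    have := hc1 l hl w (Finset.mem_univ _)
    push Not at this
    obtain ⟨x, hx, hxw⟩ := this
    exact ⟨x, hx, fun e => hw (e ▸ hx), by simpa using hxw⟩
  set q : ℝ := ∏ k ∈ Finset.range (L - 1), (1 - (1 - p) ^ (k + 1)) with hq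
  have hqe := q_bound p h0 h1 (L - 1)
  have hpp : 0 ≤ 1 - p := by linarith
  have hop : ∀ l ∈ F, (erMeasure V p).real {ω | Op ω l} = q := by
    intro l hl
    rw [er_op p h0.le h1 l (hF l hl).1.nodup, (hF l hl).2]
  have hq1 : q ≤ 1 := by
    apply Finset.prod_le_one
    · intro k _
      have := pow_le_one₀ (n := k + 1) hpp (by linarith)
      linarith
    · intro k _
      have : 0 ≤ (1 - p) ^ (k + 1) := by positivity
      linarith
  have hA : (erMeasure V p).real (⋃ l ∈ F, ⋃ w ∈ (Finset.univ : Finset V),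
      {ω : Sym2 V → Bool | ∀ x ∈ l, ω s(x, w) = false}) ≤
      Fintype.card V * (Fintype.card V * (1 - p) ^ L) := by
    calc _ ≤ ∑ l ∈ F, _ := measureReal_biUnion_finset_le _ _
      _ ≤ ∑ l ∈ F, (Fintype.card V * (1 - p) ^ L) := by
        apply Finset.sum_le_sum
        intro l hl
        calc _ ≤ ∑ w ∈ (Finset.univ : Finset V), _ := measureReal_biUnion_finset_le _ _
          _ = ∑ w ∈ (Finset.univ : Finset V), (1 - p) ^ L := by
            refine Finset.sum_congr rfl fun w _ => ?_
            rw [er_none p h0.le h1 l (hF l hl).1.nodup, (hF l hl).2]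
          _ = _ := by simp
      _ ≤ _ := by
        rw [Finset.sum_const, nsmul_eq_mul]
        gcongr
  have hB : (erMeasure V p).real {ω | ∀ l ∈ F, ¬ Op ω l} ≤
      Real.exp (-(Real.exp (-(Real.pi ^ 2 / 6 / p)) * F.card)) := by
    rw [er_family p q F hop hd]
    calc (1 - q) ^ F.card ≤ (Real.exp (-q)) ^ F.card := by
          refine pow_le_pow_left₀ (by linarith) ?_ _
          have := Real.add_one_le_exp (-q); linarith
      _ = Real.exp (-(q * F.card)) := by
          rw [← Real.exp_nat_mul]; ring_nf
      _ ≤ _ := by gcongr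
  calc _ ≤ _ := measureReal_mono hsub (measure_ne_top _ _)
    _ ≤ _ := measureReal_union_le _ _
    _ ≤ _ := add_le_add hA hB

lemma main_bound (p : ℝ) (h0 : 0 < p) (h1 : p ≤ 1) (P : SimpleGraph V) (hP : P.Connected)
    (L D : ℕ) (hL : 0 < L) (hLn : L ≤ Fintype.card V) :
    (erMeasure V p).real {ω | Solves (graphOf ω) P}ᶜ ≤
      Fintype.card V * Real.exp (-(p ^ 2 * D)) +
      Fintype.card V * (Fintype.card V * Real.exp (-(p * L))) +
      Real.exp (-(Real.exp (-(Real.pi ^ 2 / 6 / p)) *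
        (Fintype.card V / ((L + L * D * L : ℕ) : ℝ)))) := by
  classical
  have hpe : ∀ (x : ℝ) (k : ℕ), x ≤ 1 → (1 - x) ^ k ≤ Real.exp (-(x * k)) := by
    intro x k hx
    calc (1 - x) ^ k ≤ (Real.exp (-x)) ^ k := by
          refine pow_le_pow_left₀ (by linarith) ?_ _
          have := Real.add_one_le_exp (-x); linarith
      _ = Real.exp (-(x * k)) := by
          rw [← Real.exp_nat_mul]; ring_nf
  by_cases hD : ∀ v, P.degree v ≤ D
  · obtain ⟨F, a1, a2, a3, a4⟩ := exists_family P hP L D hL hLn (fun v => by convert hD v)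
    have hlow := low_deg p h0 h1 P hP L F a1 a2 a3
    have hm : (Fintype.card V / ((L + L * D * L : ℕ) : ℝ)) ≤ F.card := by
      rw [div_le_iff₀ (by positivity)]
      exact_mod_cast a4
    have e1 : (0 : ℝ) ≤ Fintype.card V * Real.exp (-(p ^ 2 * D)) := by positivity
    have e2 : (Fintype.card V : ℝ) * (Fintype.card V * (1 - p) ^ L) ≤
        Fintype.card V * (Fintype.card V * Real.exp (-(p * L))) := by
      gcongr
      exact hpe p L h1
    have e3 : Real.exp (-(Real.exp (-(Real.pi ^ 2 / 6 / p)) * F.card)) ≤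
        Real.exp (-(Real.exp (-(Real.pi ^ 2 / 6 / p)) *
        (Fintype.card V / ((L + L * D * L : ℕ) : ℝ)))) := by
      gcongr
    linarith
  · push Not at hD
    obtain ⟨v, hv⟩ := hD
    have hh := high_deg p h0.le h1 P hP D v (P.neighborFinset v) (by simp) hv
    have e1 : (Fintype.card V : ℝ) * (1 - p ^ 2) ^ D ≤ Fintype.card V * Real.exp (-(p ^ 2 * D)) := by
      gcongr
      exact hpe _ D (by nlinarith)
    have e2 : (0 : ℝ) ≤ Fintype.card V * (Fintype.card V * Real.exp (-(p * L))) := by positivity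
    have e3 : (0 : ℝ) ≤ Real.exp (-(Real.exp (-(Real.pi ^ 2 / 6 / p)) *
        (Fintype.card V / ((L + L * D * L : ℕ) : ℝ)))) := by positivity
    linarith

end Prob

end Jigsaw

namespace Jigsaw

lemma asym_bound (lam : ℝ) (hlam : Real.pi ^ 2 / 6 < lam)
    (n : ℕ) (P : SimpleGraph (Fin n)) (hP : P.Connected) (t : ℝ) (ht : t = Real.log n)
    (ht3 : 3 ≤ t) (htl : lam ≤ t) (hte : 8 * t ^ 3 ≤ Real.exp t) :
    (erMeasure (Fin n) (lam / Real.log n)).real {ω | Solves (graphOf ω) P}ᶜ ≤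
      2 * Real.exp (-t) + Real.exp (-(Real.exp ((1 - Real.pi ^ 2 / 6 / lam) * t) /
        t ^ (10 : ℝ) * (1 / 2048))) := by
  have hl1 : 1 < lam := by nlinarith [Real.pi_gt_three]
  have ht0 : 0 < t := by linarith
  have hn0 : (0 : ℝ) < n := by
    rcases Nat.eq_zero_or_pos n with h | h
    · subst h; simp at ht; linarith
    · exact_mod_cast h
  have hn : (n : ℝ) = Real.exp t := by rw [ht, Real.exp_log hn0]
  rw [← ht]
  set p := lam / t with hp
  have hp0 : 0 < p := by positivity
  have hp1 : p ≤ 1 := by rw [hp, div_le_one ht0]; exact htl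
  set k := ⌈t⌉₊ with hk
  have hk1 : t ≤ k := Nat.le_ceil t
  have hk2 : (k : ℝ) ≤ 2 * t := by
    have := Nat.ceil_lt_add_one ht0.le
    linarith
  have hk0 : 1 ≤ k := by
    have : (0 : ℝ) < k := by linarith
    exact_mod_cast this
  have hLn : k ^ 3 ≤ Fintype.card (Fin n) := by
    rw [Fintype.card_fin]
    have : ((k ^ 3 : ℕ) : ℝ) ≤ n := by
      push_cast
      rw [hn]
      calc (k : ℝ) ^ 3 ≤ (2 * t) ^ 3 := by gcongr
        _ = 8 * t ^ 3 := by ring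
        _ ≤ _ := hte
    exact_mod_cast this
  have hb := main_bound p hp0 hp1 P hP (k ^ 3) (k ^ 4) (by positivity) hLn
  rw [Fintype.card_fin, hn] at hb
  have hpt : p * t = lam := by rw [hp]; field_simp
  have e1 : Real.exp t * Real.exp (-(p ^ 2 * ((k ^ 4 : ℕ) : ℝ))) ≤ Real.exp (-t) := by
    rw [← Real.exp_add]
    apply Real.exp_le_exp.2
    have : t ^ 2 ≤ p ^ 2 * ((k ^ 4 : ℕ) : ℝ) := by
      push_cast
      calc t ^ 2 ≤ lam ^ 2 * t ^ 2 := by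
            have : 1 ≤ lam ^ 2 := by nlinarith
            nlinarith [sq_nonneg t]
        _ = p ^ 2 * t ^ 4 := by rw [← hpt]; ring
        _ ≤ _ := by gcongr
    nlinarith
  have e2 : Real.exp t * (Real.exp t * Real.exp (-(p * ((k ^ 3 : ℕ) : ℝ)))) ≤ Real.exp (-t) := by
    rw [← Real.exp_add, ← Real.exp_add]
    apply Real.exp_le_exp.2
    have : t ^ 2 ≤ p * ((k ^ 3 : ℕ) : ℝ) := by
      push_cast
      calc t ^ 2 ≤ lam * t ^ 2 := by nlinarith [sq_nonneg t]
        _ = p * t ^ 3 := by rw [← hpt]; ring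
        _ ≤ _ := by gcongr
    nlinarith
  have e3 : Real.exp ((1 - Real.pi ^ 2 / 6 / lam) * t) / t ^ (10 : ℝ) * (1 / 2048) ≤
      Real.exp (-(Real.pi ^ 2 / 6 / p)) *
        (Real.exp t / ((k ^ 3 + k ^ 3 * k ^ 4 * k ^ 3 : ℕ) : ℝ)) := by
    have h1 : Real.exp ((1 - Real.pi ^ 2 / 6 / lam) * t) =
        Real.exp (-(Real.pi ^ 2 / 6 / p)) * Real.exp t := by
      rw [← Real.exp_add]
      congr 1
      rw [hp]
      field_simp
      ring
    have h2 : ((k ^ 3 + k ^ 3 * k ^ 4 * k ^ 3 : ℕ) : ℝ) ≤ 2048 * t ^ 10 := by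
      push_cast
      have hk0' : (1 : ℝ) ≤ k := by exact_mod_cast hk0
      calc (k : ℝ) ^ 3 + k ^ 3 * k ^ 4 * k ^ 3 ≤ k ^ 10 + k ^ 10 := by
            have : (k : ℝ) ^ 3 ≤ k ^ 10 := pow_le_pow_right₀ hk0' (by norm_num)
            have h' : (k : ℝ) ^ 3 * k ^ 4 * k ^ 3 = k ^ 10 := by ring
            linarith
        _ ≤ (2 * t) ^ 10 + (2 * t) ^ 10 := by gcongr
        _ = 2048 * t ^ 10 := by ring
    have h3 : t ^ (10 : ℝ) = t ^ 10 := by exact_mod_cast Real.rpow_natCast t 10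
    rw [h1, h3]
    calc Real.exp (-(Real.pi ^ 2 / 6 / p)) * Real.exp t / t ^ 10 * (1 / 2048)
        = Real.exp (-(Real.pi ^ 2 / 6 / p)) * (Real.exp t / (2048 * t ^ 10)) := by field_simp
      _ ≤ _ := by
        have : (0 : ℝ) < ((k ^ 3 + k ^ 3 * k ^ 4 * k ^ 3 : ℕ) : ℝ) := by positivity
        gcongr
  have e4 := Real.exp_le_exp.2 (neg_le_neg e3)
  linarith

end Jigsaw

open MeasureTheory Filter Topology

/-- For any sequence of connected puzzle graphs on `n` vertices and an
Erdős–Rényi people graph with `p_n = λ / log n`, `λ > π²/6`, the probability of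
solving tends to `1`. -/
theorem jigsaw_upper (lam : ℝ) (hlam : Real.pi ^ 2 / 6 < lam)
    (P : (n : ℕ) → SimpleGraph (Fin n)) (hconn : ∀ n, 0 < n → (P n).Connected) :
    Tendsto
      (fun n : ℕ =>
        Jigsaw.erMeasure (Fin n) (lam / Real.log n)
          {ω | Jigsaw.Solves (Jigsaw.graphOf ω) (P n)})
      atTop (𝓝 1) := by

  have hpi : 0 < Real.pi := Real.pi_pos
  have hl0 : 0 < lam := lt_trans (by positivity) hlam
  have htend : Tendsto (fun n : ℕ => Real.log n) atTop atTop :=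
    Real.tendsto_log_atTop.comp tendsto_natCast_atTop_atTop
  have hc : 0 < 1 - Real.pi ^ 2 / 6 / lam := by
    rw [sub_pos, div_lt_one hl0]; exact hlam
  let g : ℝ → ℝ := fun t => 2 * Real.exp (-t) +
    Real.exp (-(Real.exp ((1 - Real.pi ^ 2 / 6 / lam) * t) / t ^ (10 : ℝ) * (1 / 2048)))
  have hg : Tendsto g atTop (𝓝 0) := by
    have h1 : Tendsto (fun t : ℝ => 2 * Real.exp (-t)) atTop (𝓝 0) := by
      simpa using (Real.tendsto_exp_neg_atTop_nhds_zero).const_mul 2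
    have h2 := (tendsto_exp_mul_div_rpow_atTop 10 _ hc).atTop_mul_const
      (show (0 : ℝ) < 1 / 2048 by norm_num)
    have h3 := Real.tendsto_exp_neg_atTop_nhds_zero.comp h2
    have h4 := h1.add h3
    rw [add_zero] at h4
    exact h4
  have hexp : ∀ᶠ t : ℝ in atTop, 8 * t ^ 3 ≤ Real.exp t := by
    filter_upwards [(Real.tendsto_exp_div_pow_atTop 3).eventually_ge_atTop 8,
      eventually_gt_atTop 0] with t ht ht0
    rwa [le_div_iff₀ (by positivity)] at ht
  have hev : ∀ᶠ n : ℕ in atTop,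
      (Jigsaw.erMeasure (Fin n) (lam / Real.log n)).real
        {ω | Jigsaw.Solves (Jigsaw.graphOf ω) (P n)}ᶜ ≤ g (Real.log n) := by
    filter_upwards [htend.eventually hexp, htend.eventually_ge_atTop 3,
      htend.eventually_ge_atTop lam, eventually_gt_atTop 0] with n h1 h2 h3 h4
    exact Jigsaw.asym_bound lam hlam n (P n) (hconn n h4) _ rfl h2 h3 h1
  have hreal : Tendsto (fun n : ℕ => (Jigsaw.erMeasure (Fin n) (lam / Real.log n)).real
        {ω | Jigsaw.Solves (Jigsaw.graphOf ω) (P n)}) atTop (𝓝 1) := by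
    have h0 : Tendsto (fun n : ℕ => (Jigsaw.erMeasure (Fin n) (lam / Real.log n)).real
        {ω | Jigsaw.Solves (Jigsaw.graphOf ω) (P n)}ᶜ) atTop (𝓝 0) :=
      tendsto_of_tendsto_of_tendsto_of_le_of_le' tendsto_const_nhds (hg.comp htend)
        (Eventually.of_forall fun n => measureReal_nonneg) hev
    have h1 := h0.const_sub 1
    rw [sub_zero] at h1
    refine h1.congr fun n => ?_
    rw [Jigsaw.er_compl]
    ring
  have := ENNReal.tendsto_ofReal hreal
  rw [ENNReal.ofReal_one] at this
  refine this.congr fun n => ?_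
  exact ENNReal.ofReal_toReal (measure_ne_top _ _)
end

section
/- Let m ≥ 1 be a fixed integer. For any connected simple graph G with vertex set V, there exist an integer k ≥ |V|/(2m) and subsets B_1, B_2, …, B_k of V such that: (i) V = B_1 ∪ B_2 ∪ ⋯ ∪ B_k; (ii) |B_i| ∈ [m, 2m] for i = 1, …, k−1 and |B_k| < 2m; (iii) the subgraph of G induced on B_i is connected for every i = 1, …, k; and (iv) |B_i ∩ B_j| ≤ 1 for all 1 ≤ i < j ≤ k. -/
open MeasureTheory Filter Topology

/-- The subgraph induced on a finset is connected. -/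
def FConn {V : Type*} (G : SimpleGraph V) (S : Finset V) : Prop :=
  (SimpleGraph.induce (↑S : Set V) G).Connected

namespace FConn

variable {V : Type*} [DecidableEq V] {G : SimpleGraph V}

lemma nonempty {S : Finset V} (h : FConn G S) : S.Nonempty := by
  obtain ⟨v, hv⟩ := SimpleGraph.Connected.nonempty h
  exact ⟨v, hv⟩

lemma singleton (v : V) : FConn G {v} := by
  unfold FConn
  have : Subsingleton ((({v} : Finset V) : Set V)) := by
    simp
  exact { preconnected := .of_subsingleton, nonempty := ⟨⟨v, by simp⟩⟩ }

lemma union {S T : Finset V} (hS : FConn G S) (hT : FConn G T) {x : V} (hx : x ∈ S)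
    (hx2 : x ∈ T) : FConn G (S ∪ T) := by
  unfold FConn
  rw [Finset.coe_union]
  exact SimpleGraph.induce_union_connected hS.preconnected hT.preconnected ⟨x, hx, hx2⟩

lemma union_adj {S T : Finset V} (hS : FConn G S) (hT : FConn G T) {x y : V} (hx : x ∈ S)
    (hy : y ∈ T) (ha : G.Adj x y) : FConn G (S ∪ T) := by
  unfold FConn
  rw [Finset.coe_union]
  exact SimpleGraph.connected_induce_union hS.preconnected hT.preconnected hx hy ha

lemma exists_edge {S T : Finset V} (hS : FConn G S) (hTS : T ⊆ S) (hT : T.Nonempty)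
    (hne : T ≠ S) : ∃ x ∈ T, ∃ y ∈ S, y ∉ T ∧ G.Adj x y := by
  obtain ⟨a, ha⟩ := hT
  obtain ⟨b, hb, hbT⟩ : ∃ b ∈ S, b ∉ T := by
    by_contra! h
    exact hne (Finset.Subset.antisymm hTS h)
  obtain ⟨p⟩ := hS.preconnected ⟨a, hTS ha⟩ ⟨b, hb⟩
  obtain ⟨d, -, h1, h2⟩ := p.exists_boundary_dart {z | z.1 ∈ T} ha hbT
  exact ⟨d.fst.1, h1, d.snd.1, d.snd.2, h2, d.adj⟩

/-- Splitting off a component of `A` minus `x`. -/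
lemma exists_split {A : Finset V} (hA : FConn G A) {x : V} (hx : x ∈ A) (hc : 2 ≤ A.card) :
    ∃ C ⊆ A, x ∉ C ∧ FConn G C ∧ FConn G (A \ C) ∧ ∃ y ∈ C, G.Adj x y := by
  classical
  obtain ⟨x', hx', y, hy, hyx, hadj⟩ := hA.exists_edge (T := {x}) (by simpa using hx)
    (by simp) (by rintro rfl; simp at hc)
  obtain rfl : x' = x := by simpa using hx'
  have hyx' : x' ≠ y := by rintro rfl; simp at hyx
  obtain ⟨C, hC, hmax⟩ := Finset.exists_max_image
    (A.powerset.filter (fun C => x' ∉ C ∧ FConn G C ∧ y ∈ C)) Finset.card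
    ⟨{y}, by simp [hy, hyx', singleton]⟩
  simp only [Finset.mem_filter, Finset.mem_powerset] at hC hmax
  obtain ⟨hCA, hxC, hCc, hyC⟩ := hC
  obtain ⟨D, hD, hDmax⟩ := Finset.exists_max_image
    ((A \ C).powerset.filter (fun D => FConn G D ∧ x' ∈ D)) Finset.card
    ⟨{x'}, by simp [hx, hxC, singleton]⟩
  simp only [Finset.mem_filter, Finset.mem_powerset] at hD hDmax
  obtain ⟨hDA, hDc, hxD⟩ := hD
  refine ⟨C, hCA, hxC, hCc, ?_, y, hyC, hadj⟩
  suffices D = A \ C by rwa [← this]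
  by_contra hne
  have hss : D ∪ C ⊆ A := Finset.union_subset (hDA.trans Finset.sdiff_subset) hCA
  obtain ⟨u, hu, w, hw, hwn, huw⟩ := hA.exists_edge hss ⟨x', by simp [hxD]⟩ (by
    intro h
    apply hne
    apply Finset.Subset.antisymm hDA
    intro z hz
    rw [← h] at hz
    simp at hz
    tauto)
  simp only [Finset.mem_union, not_or] at hu hwn
  rcases hu with hu | hu
  · have := hDmax (D ∪ {w}) ⟨Finset.union_subset hDA (by simp [hw, hwn.2]),
      hDc.union_adj (singleton w) hu (by simp) huw, by simp [hxD]⟩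
    rw [Finset.card_union_of_disjoint (by simp [hwn.1])] at this
    simp at this
  · have hxw : x' ≠ w := by rintro rfl; exact hwn.1 hxD
    have := hmax (C ∪ {w}) ⟨Finset.union_subset hCA (by simp [hw]), by simp [hxC, hxw],
      hCc.union_adj (singleton w) hu (by simp) huw, by simp [hyC]⟩
    rw [Finset.card_union_of_disjoint (by simp [hwn.2])] at this
    simp at this

/-- Extracting one block. -/
lemma exists_block {S : Finset V} (hS : FConn G S) {m : ℕ} (hm : 1 ≤ m) (hc : m + 1 ≤ S.card) :
    ∃ A ⊆ S, ∃ x ∈ A, FConn G A ∧ FConn G (S \ A ∪ {x}) ∧ m + 1 ≤ A.card ∧ A.card ≤ 2 * m := by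
  classical
  obtain ⟨x0, hx0⟩ := hS.nonempty
  obtain ⟨A, hA, hmin⟩ := Finset.exists_min_image
    (S.powerset.filter (fun A => ∃ x ∈ A, FConn G A ∧ FConn G (S \ A ∪ {x}) ∧ m + 1 ≤ A.card))
    Finset.card ⟨S, by
      simp only [Finset.mem_filter, Finset.mem_powerset]
      exact ⟨subset_rfl, x0, hx0, hS, by simpa using singleton x0, hc⟩⟩
  simp only [Finset.mem_filter, Finset.mem_powerset] at hA hmin
  obtain ⟨hAS, x, hx, hAc, hR, hcard⟩ := hA
  refine ⟨A, hAS, x, hx, hAc, hR, hcard, ?_⟩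
  by_contra! hbig
  obtain ⟨C, hCA, hxC, hCc, hDc, y, hy, hxy⟩ := hAc.exists_split hx (by omega)
  have hCpos : 0 < C.card := Finset.card_pos.2 ⟨y, hy⟩
  have hsd := Finset.card_sdiff_add_card_eq_card hCA
  by_cases hCm : m + 1 ≤ C.card
  · have := hmin C ⟨hCA.trans hAS, y, hy, hCc, ?_, hCm⟩
    · have : C.card < A.card :=
        Finset.card_lt_card ⟨hCA, fun h => hxC (h hx)⟩
      omega
    · have h1 := (hR.union hDc (x := x) (by simp) (by simp [hx, hxC])).union_adj
        (singleton y) (x := x) (y := y) (by simp) (by simp) hxy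
      convert h1 using 1
      ext z
      have := @hCA z
      have := @hAS z
      have : z = x → z ∈ A := by rintro rfl; exact hx
      have : z = x → z ∉ C := by rintro rfl; exact hxC
      simp only [Finset.mem_union, Finset.mem_sdiff, Finset.mem_singleton]
      tauto
  · have := hmin (A \ C) ⟨Finset.sdiff_subset.trans hAS, x, by simp [hx, hxC], hDc, ?_, by omega⟩
    · omega
    · have h1 := hR.union_adj hCc (x := x) (by simp) hy hxy
      convert h1 using 1
      ext z
      have := @hCA z
      have := @hAS z
      simp only [Finset.mem_union, Finset.mem_sdiff, Finset.mem_singleton]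
      tauto

lemma exists_blocks {m : ℕ} (hm : 1 ≤ m) (n : ℕ) : ∀ S : Finset V, S.card = n → FConn G S →
    ∃ (k : ℕ) (B : Fin k → Finset V), 0 < k ∧
      (∀ v ∈ S, ∃ i : Fin k, v ∈ B i) ∧ (∀ i, B i ⊆ S) ∧
      (∀ i : Fin k, (i : ℕ) + 1 < k → m ≤ (B i).card ∧ (B i).card ≤ 2 * m) ∧
      (∀ i : Fin k, (i : ℕ) + 1 = k → (B i).card < 2 * m) ∧
      (∀ i : Fin k, FConn G (B i)) ∧
      (∀ i j : Fin k, i < j → (B i ∩ B j).card ≤ 1) := by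
  induction n using Nat.strong_induction_on with
  | _ n ih =>
  intro S hSn hS
  by_cases hlt : S.card < 2 * m
  · refine ⟨1, fun _ => S, one_pos, fun v hv => ⟨0, hv⟩, fun _ => subset_rfl, ?_,
      fun _ _ => hlt, fun _ => hS, ?_⟩
    · intro i hi; omega
    · intro i j hij; omega
  obtain ⟨A, hAS, x, hx, hA, hR, h1, h2⟩ := hS.exists_block hm (by omega)
  have hsd := Finset.card_sdiff_add_card_eq_card hAS
  have hle := Finset.card_union_le (S \ A) {x}
  rw [Finset.card_singleton] at hle
  obtain ⟨k, B, hk, hcov, hsub, hs1, hs2, hcn, hint⟩ :=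
    ih (S \ A ∪ {x}).card (by omega) _ rfl hR
  have key : ∀ j, (A ∩ B j).card ≤ 1 := by
    intro j
    refine (Finset.card_le_card (t := {x}) ?_).trans (by simp)
    intro z hz
    rw [Finset.mem_inter] at hz
    have := hsub j hz.2
    simp only [Finset.mem_union, Finset.mem_sdiff, Finset.mem_singleton] at this ⊢
    tauto
  refine ⟨k + 1, Fin.cons A B, by omega, ?_, ?_, ?_, ?_, ?_, ?_⟩
  · intro v hv
    by_cases hvA : v ∈ A
    · exact ⟨0, by simpa using hvA⟩
    · obtain ⟨i, hi⟩ := hcov v (by simp [hv, hvA])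
      exact ⟨i.succ, by simpa using hi⟩
  · intro i
    refine Fin.cases (by simpa using hAS) (fun j => ?_) i
    simp only [Fin.cons_succ]
    refine (hsub j).trans (Finset.union_subset Finset.sdiff_subset ?_)
    simpa using hAS hx
  · intro i
    refine Fin.cases (fun _ => ?_) (fun j hj => ?_) i
    · simp only [Fin.cons_zero]; omega
    · simp only [Fin.cons_succ, Fin.val_succ] at hj ⊢
      exact hs1 j (by omega)
  · intro i
    refine Fin.cases (fun h => ?_) (fun j hj => ?_) i
    · simp only [Fin.val_zero] at h; omega
    · simp only [Fin.cons_succ, Fin.val_succ] at hj ⊢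
      exact hs2 j (by omega)
  · intro i
    refine Fin.cases (by simpa using hA) (fun j => ?_) i
    simpa using hcn j
  · intro i j
    refine Fin.cases ?_ (fun j' => ?_) j
    · intro h; exact absurd h (Fin.not_lt_zero i)
    · refine Fin.cases (fun _ => ?_) (fun i' h => ?_) i
      · simpa using key j'
      · simpa using hint i' j' (Fin.succ_lt_succ_iff.1 h)

end FConn

/-- Any finite connected graph can be covered by `k ≥ |V|/(2m)`
blocks, all but the last of size in `[m, 2m]` and the last of size `< 2m`, each
inducing a connected subgraph, and pairwise sharing at most one vertex. -/
theorem connected_graph_block_decomposition {V : Type*} [Fintype V] [DecidableEq V]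
    (m : ℕ) (hm : 1 ≤ m) (G : SimpleGraph V) (hG : G.Connected) :
    ∃ (k : ℕ) (B : Fin k → Finset V),
      (Fintype.card V : ℝ) / (2 * m) ≤ (k : ℝ) ∧
      (∀ v : V, ∃ i : Fin k, v ∈ B i) ∧
      (∀ i : Fin k, (i : ℕ) + 1 < k → m ≤ (B i).card ∧ (B i).card ≤ 2 * m) ∧
      (∀ i : Fin k, (i : ℕ) + 1 = k → (B i).card < 2 * m) ∧
      (∀ i : Fin k, (SimpleGraph.induce (↑(B i) : Set V) G).Connected) ∧
      (∀ i j : Fin k, i < j → (B i ∩ B j).card ≤ 1) := by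
  have hU : FConn G Finset.univ := by
    unfold FConn
    rw [Finset.coe_univ]
    exact (SimpleGraph.induceUnivIso G).connected_iff.2 hG
  obtain ⟨k, B, hk, hcov, hsub, hs1, hs2, hcn, hint⟩ := FConn.exists_blocks hm _ _ rfl hU
  refine ⟨k, B, ?_, fun v => hcov v (Finset.mem_univ v), hs1, hs2, hcn, hint⟩
  have hle : Fintype.card V ≤ k * (2 * m) := by
    have h1 : (Finset.univ : Finset V) ⊆ Finset.univ.biUnion B := by
      intro v hv
      simpa using hcov v hv
    have h2 := (Finset.card_le_card h1).trans
      (Finset.card_biUnion_le_card_mul Finset.univ B (2 * m) ?_)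
    · simpa using h2
    · intro i _
      rcases Nat.lt_or_ge (i.1 + 1) k with h | h
      · exact (hs1 i h).2
      · exact (hs2 i (by omega)).le
  have hm' : (0 : ℝ) < 2 * m := by
    have : (0 : ℝ) < m := by exact_mod_cast hm
    linarith
  rw [div_le_iff₀ hm']
  exact_mod_cast hle
end
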